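/- arXiv:2309.02806 — 2 statements merged into one kernel-verified Lean document; each statement's English description precedes it below -/
import Mathlib

section
/- Assume c(x,y) = k(y−x) with k satisfying (H1). For every m > 0 there exists R = R(m) such that for all f_1, f_2 ∈ L^1_m with f_1 + f_2 ≤ 1: if the gap between supp f_1 and supp f_2 is at least R (i.e. |a − b| ≥ R for all a ∈ supp f_1, b ∈ supp f_2), then Υ(f_1 + f_2) = Υ(f_1) + Υ(f_2). -/
open MeasureTheory ENNReal Filter Set

noncomputable section

/-- Euclidean space `ℝ^d`. -/
abbrev Rd (d : ℕ) : Type := EuclideanSpace ℝ (Fin d)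

/-- The measure `f · Leb` on `ℝ^d`. -/
def fMeas {d : ℕ} (f : Rd d → ℝ) : Measure (Rd d) :=
  MeasureTheory.volume.withDensity fun x => ENNReal.ofReal (f x)

/-- The set `Π_f` of admissible exterior transport plans: first marginal `f · Leb`,
second marginal `≤ (1 - f) · Leb`. -/
def ExtPlans {d : ℕ} (f : Rd d → ℝ) : Set (Measure (Rd d × Rd d)) :=
  {γ | γ.map Prod.fst = fMeas f ∧ γ.map Prod.snd ≤ fMeas fun x => 1 - f x}

/-- The transport cost `∫ c dγ` of a plan `γ`. -/
def planCost {d : ℕ} (c : Rd d → Rd d → ℝ) (γ : Measure (Rd d × Rd d)) : ℝ≥0∞ :=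
  ∫⁻ p, ENNReal.ofReal (c p.1 p.2) ∂γ

/-- The functional `Υ(f) = inf { ∫ c dγ : γ ∈ Π_f }`. -/
def Ups {d : ℕ} (c : Rd d → Rd d → ℝ) (f : Rd d → ℝ) : ℝ≥0∞ :=
  ⨅ γ ∈ ExtPlans f, planCost c γ

/-- `f ∈ L¹(ℝ^d, [0,1])`. -/
def InUnit {d : ℕ} (f : Rd d → ℝ) : Prop :=
  Integrable f MeasureTheory.volume ∧ ∀ x, 0 ≤ f x ∧ f x ≤ 1

/-- `f ∈ L¹_m`: in `L¹(ℝ^d,[0,1])` with `∫ f ≤ m`. -/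
def MemL1m {d : ℕ} (m : ℝ) (f : Rd d → ℝ) : Prop := InUnit f ∧ (∫ x, f x) ≤ m

/-- The energy `ℰ(m) = sup { Υ(f) : f ∈ L¹(ℝ^d,[0,1]), ∫ f = m }`. -/
def Energy {d : ℕ} (c : Rd d → Rd d → ℝ) (m : ℝ) : ℝ≥0∞ :=
  ⨆ f ∈ {f : Rd d → ℝ | InUnit f ∧ (∫ x, f x) = m}, Ups c f

/-- Hypothesis (H1): `k` continuous, `k 0 = 0`, `k → ∞` at infinity. -/
def H1 {d : ℕ} (k : Rd d → ℝ) : Prop :=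
  Continuous k ∧ k 0 = 0 ∧ Tendsto k (Bornology.cobounded (Rd d)) atTop

/-- Hypothesis (H2). -/
def H2 {d : ℕ} (k : Rd d → ℝ) : Prop :=
  ∀ x : Rd d, x ≠ 0 →
    0 < Filter.limsup
      (fun r : ℝ =>
        MeasureTheory.volume (Metric.ball x r ∩ {y | k y < k x}) / ENNReal.ofReal (r ^ d))
      (nhdsWithin 0 (Set.Ioi 0))

/-- Hypothesis (H3): `r ↦ k (r σ)` increasing on `[0, ∞)` for every unit direction `σ`. -/
def H3 {d : ℕ} (k : Rd d → ℝ) : Prop :=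
  ∀ σ : Rd d, ‖σ‖ = 1 → StrictMonoOn (fun r : ℝ => k (r • σ)) (Set.Ici 0)

/-- Translation-invariant cost `c(x,y) = k(y - x)`. -/
def transCost {d : ℕ} (k : Rd d → ℝ) : Rd d → Rd d → ℝ := fun x y => k (y - x)

/-- The support of a measure: points all of whose open neighbourhoods have positive measure. -/
def msupport {α : Type*} [TopologicalSpace α] [MeasurableSpace α] (μ : Measure α) : Set α :=
  {x | ∀ U : Set α, IsOpen U → x ∈ U → 0 < μ U}

/-- `ℝ^d`, `d ≥ 1`, has a countable measurable partition into cells of uniformly bounded diameter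
and of finite volume at least `v`. -/
lemma exists_bounded_partition {d : ℕ} (hd : 1 ≤ d) (v : ℝ) :
    ∃ (Q : (Fin d → ℤ) → Set (Rd d)) (ρ : ℝ), (∀ i, MeasurableSet (Q i)) ∧
      Pairwise (Function.onFun Disjoint Q) ∧ (⋃ i, Q i) = univ ∧
      (∀ i, ∀ x ∈ Q i, ∀ y ∈ Q i, dist x y ≤ ρ) ∧
      ∀ i, ENNReal.ofReal v ≤ volume (Q i) ∧ volume (Q i) ≠ ⊤ := by
  set L : ℝ := max 1 v
  have hL1 : 1 ≤ L := le_max_left _ _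
  have hL0 : 0 < L := by linarith
  have hfloor : ∀ (t : ℝ) (n : ℤ), ⌊t / L⌋ = n ↔ t ∈ Ico (n * L) ((n + 1) * L) := by
    intro t n
    rw [Int.floor_eq_iff, le_div_iff₀ hL0, div_lt_iff₀ hL0, mem_Ico]
  have hvol : ∀ i : Fin d → ℤ, volume {x : Rd d | ∀ j, ⌊x j / L⌋ = i j} = ENNReal.ofReal L ^ d := by
    intro i
    have e : {x : Rd d | ∀ j, ⌊x j / L⌋ = i j} =
        (MeasurableEquiv.toLp 2 (Fin d → ℝ)).symm ⁻¹'
          (Set.pi univ fun j => Ico (i j * L) ((i j + 1) * L)) := by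
      ext x
      simp only [mem_ofPred_eq, hfloor, mem_preimage, Set.mem_pi, mem_univ, forall_true_left]
      rfl
    rw [e, (EuclideanSpace.volume_preserving_symm_measurableEquiv_toLp (Fin d)).measure_preimage
      (MeasurableSet.univ_pi fun j => measurableSet_Ico).nullMeasurableSet, Real.volume_pi_Ico]
    simp [add_mul]
  refine ⟨fun i => {x | ∀ j, ⌊x j / L⌋ = i j}, Real.sqrt (∑ _j : Fin d, L ^ 2), ?_, ?_, ?_, ?_, ?_⟩
  · intro i
    simp only [ofPred_forall]
    refine MeasurableSet.iInter fun j => ?_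
    have : Measurable fun x : Rd d => ⌊x j / L⌋ :=
      Int.measurable_floor.comp (by fun_prop)
    exact this (measurableSet_singleton (i j))
  · intro i i' hne
    refine Set.disjoint_left.2 fun x hx hx' => hne ?_
    funext j
    exact (hx j).symm.trans (hx' j)
  · exact eq_univ_of_forall fun x => mem_iUnion.2 ⟨fun j => ⌊x j / L⌋, fun _ => rfl⟩
  · intro i x hx y hy
    rw [EuclideanSpace.dist_eq]
    refine Real.sqrt_le_sqrt (Finset.sum_le_sum fun j _ => ?_)
    have h1 := (hfloor _ _).1 (hx j)
    have h2 := (hfloor _ _).1 (hy j)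
    simp only [mem_Ico] at h1 h2
    rw [Real.dist_eq]
    refine pow_le_pow_left₀ (abs_nonneg _) ?_ 2
    rw [abs_le]
    constructor <;> nlinarith
  · intro i
    rw [hvol]
    refine ⟨?_, by finiteness⟩
    rw [← ENNReal.ofReal_pow hL0.le]
    refine ENNReal.ofReal_le_ofReal ?_
    calc v ≤ L := le_max_right _ _
      _ ≤ L ^ d := le_self_pow₀ hL1 (by omega)

lemma fMeas_apply {d : ℕ} (f : Rd d → ℝ) {E : Set (Rd d)} (hE : MeasurableSet E) :
    fMeas f E = ∫⁻ x in E, ENNReal.ofReal (f x) :=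
  withDensity_apply _ hE

lemma fMeas_mono {d : ℕ} {f g : Rd d → ℝ} (h : ∀ x, f x ≤ g x) : fMeas f ≤ fMeas g :=
  withDensity_mono (Eventually.of_forall fun x => ENNReal.ofReal_le_ofReal (h x))

lemma fMeas_add_le {d : ℕ} {f : Rd d → ℝ} (hf : AEMeasurable f) (g : Rd d → ℝ) :
    fMeas (fun x => f x + g x) ≤ fMeas f + fMeas g := by
  refine Measure.le_iff.2 fun E hE => ?_
  rw [Measure.add_apply, fMeas_apply _ hE, fMeas_apply _ hE, fMeas_apply _ hE,
    ← lintegral_add_left' hf.restrict.ennreal_ofReal]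
  exact lintegral_mono fun x => ENNReal.ofReal_add_le

lemma fMeas_add {d : ℕ} {f g : Rd d → ℝ} (hf : AEMeasurable f) (hf0 : ∀ x, 0 ≤ f x)
    (hg0 : ∀ x, 0 ≤ g x) : fMeas (fun x => f x + g x) = fMeas f + fMeas g := by
  refine Measure.ext fun E hE => ?_
  rw [Measure.add_apply, fMeas_apply _ hE, fMeas_apply _ hE, fMeas_apply _ hE,
    ← lintegral_add_left' hf.restrict.ennreal_ofReal]
  exact lintegral_congr fun x => ENNReal.ofReal_add (hf0 x) (hg0 x)

lemma fMeas_one {d : ℕ} : fMeas (fun _ : Rd d => (1 : ℝ)) = volume := by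
  simp only [fMeas, ENNReal.ofReal_one]
  exact withDensity_one

lemma MemL1m.fMeas_univ_le {d : ℕ} {m : ℝ} {f : Rd d → ℝ} (hf : MemL1m m f) :
    fMeas f univ ≤ ENNReal.ofReal m := by
  rw [fMeas_apply _ MeasurableSet.univ, Measure.restrict_univ,
    ← ofReal_integral_eq_lintegral_ofReal hf.1.1 (Eventually.of_forall fun x => (hf.1.2 x).1)]
  exact ENNReal.ofReal_le_ofReal hf.2

/-- If `μ` and `V` are measures such that `μ (Q i) ≤ V (Q i)` on each cell of a countable
partition, `μ` can be transported cell by cell onto a measure dominated by `V`. -/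
lemma exists_transport_in_cells {α ι : Type*} [MeasurableSpace α] [Countable ι]
    {Q : ι → Set α} (hQ : ∀ i, MeasurableSet (Q i)) (hdisj : Pairwise (Function.onFun Disjoint Q))
    (hU : (⋃ i, Q i) = univ) (μ V : Measure α) [SFinite μ]
    (hle : ∀ i, μ (Q i) ≤ V (Q i)) (h0 : ∀ i, V (Q i) ≠ 0) (hfin : ∀ i, V (Q i) ≠ ⊤) :
    ∃ η : Measure (α × α), η.map Prod.fst = μ ∧ η.map Prod.snd ≤ V ∧
      ∀ᵐ p ∂η, ∃ i, p.1 ∈ Q i ∧ p.2 ∈ Q i := by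
  have hsum : ∀ ξ : Measure α, Measure.sum (fun i => ξ.restrict (Q i)) = ξ := by
    intro ξ
    rw [← Measure.restrict_iUnion hdisj hQ, hU, Measure.restrict_univ]
  have hVfin : ∀ i, IsFiniteMeasure (V.restrict (Q i)) := fun i =>
    ⟨by simpa using (hfin i).lt_top⟩
  have hVs : SFinite V := hsum V ▸ inferInstance
  refine ⟨Measure.sum fun i => (V (Q i))⁻¹ • (μ.restrict (Q i)).prod (V.restrict (Q i)),
    ?_, ?_, ?_⟩
  · rw [Measure.map_sum measurable_fst.aemeasurable]
    conv_rhs => rw [← hsum μ]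
    congr 1
    funext i
    rw [Measure.map_smul, Measure.map_fst_prod, smul_smul, Measure.restrict_apply_univ,
      ENNReal.inv_mul_cancel (h0 i) (hfin i), one_smul]
  · rw [Measure.map_sum measurable_snd.aemeasurable]
    conv_rhs => rw [← hsum V]
    refine Measure.le_iff.2 fun E hE => ?_
    rw [Measure.sum_apply _ hE, Measure.sum_apply _ hE]
    refine ENNReal.tsum_le_tsum fun i => ?_
    rw [Measure.map_smul, Measure.map_snd_prod, smul_smul, Measure.restrict_apply_univ,
      Measure.smul_apply, smul_eq_mul]
    refine mul_le_of_le_one_left' ?_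
    calc (V (Q i))⁻¹ * μ (Q i) ≤ (V (Q i))⁻¹ * V (Q i) := mul_le_mul_right (hle i) _
      _ = 1 := ENNReal.inv_mul_cancel (h0 i) (hfin i)
  · rw [Measure.ae_sum_iff]
    intro i
    refine Measure.ae_smul_measure ?_ _
    rw [Measure.prod_restrict]
    filter_upwards [ae_restrict_mem ((hQ i).prod (hQ i))] with p hp
    exact ⟨i, hp⟩

/-- Under (H1), any plan for a density of mass at most `m` can be replaced by one of bounded
displacement without increasing the cost. -/
lemma exists_plan_bounded_displacement {d : ℕ} (hd : 1 ≤ d) {k : Rd d → ℝ} (h1 : H1 k)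
    {m : ℝ} (hm : 0 < m) :
    ∃ D : ℝ, ∀ f : Rd d → ℝ, MemL1m m f → ∀ γ ∈ ExtPlans f, ∃ γ' ∈ ExtPlans f,
      planCost (transCost k) γ' ≤ planCost (transCost k) γ ∧ ∀ᵐ p ∂γ', dist p.1 p.2 ≤ D := by
  obtain ⟨Q, ρ, hQ, hdisj, hU, hdiam, hvol⟩ := exists_bounded_partition hd (3 * m)
  obtain ⟨hk, -, hlim⟩ := h1
  obtain ⟨K, hK⟩ := (isCompact_closedBall (0 : Rd d) ρ).bddAbove_image hk.continuousOn
  obtain ⟨r, hr⟩ : ∃ r : ℝ, ∀ z : Rd d, r < ‖z‖ → K ≤ k z := by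
    obtain ⟨r, -, hr⟩ := (Metric.hasBasis_cobounded_compl_closedBall (0 : Rd d)).eventually_iff.1
      (hlim.eventually_ge_atTop K)
    exact ⟨r, fun z hz => hr (by simpa using hz)⟩
  refine ⟨max ρ r, fun f hf γ hγ => ?_⟩
  obtain ⟨hγ1, hγ2⟩ := hγ
  set W : Measure (Rd d) := fMeas fun x => 1 - f x with hW
  have hγU : γ univ ≤ ENNReal.ofReal m := by
    rw [← preimage_univ (f := Prod.fst), ← Measure.map_apply measurable_fst MeasurableSet.univ, hγ1]
    exact hf.fMeas_univ_le
  have hγfin : IsFiniteMeasure γ := ⟨hγU.trans_lt ENNReal.ofReal_lt_top⟩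
  set F : Set (Rd d × Rd d) := {p | max ρ r < dist p.1 p.2}
  have hFm : MeasurableSet F := (isOpen_lt continuous_const continuous_dist).measurableSet
  set ν : Measure (Rd d) := (γ.restrict Fᶜ).map Prod.snd with hν
  set μ : Measure (Rd d) := (γ.restrict F).map Prod.fst with hμ
  have hνW : ν ≤ W := (Measure.map_mono Measure.restrict_le_self measurable_snd).trans hγ2
  have hνU : ν univ ≤ ENNReal.ofReal m := by
    rw [hν, Measure.map_apply measurable_snd MeasurableSet.univ]
    exact (Measure.restrict_le_self _).trans hγU
  have hμU : μ univ ≤ ENNReal.ofReal m := by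
    rw [hμ, Measure.map_apply measurable_fst MeasurableSet.univ]
    exact (Measure.restrict_le_self _).trans hγU
  have hVν : (W - ν) + ν = W := Measure.sub_add_cancel_of_le hνW
  set V : Measure (Rd d) := W - ν
  have hVm : ∀ i, ENNReal.ofReal m ≤ V (Q i) := by
    intro i
    have hle : volume (Q i) ≤ fMeas f (Q i) + W (Q i) := by
      rw [← fMeas_one, ← Measure.add_apply]
      refine le_trans (le_of_eq ?_) (fMeas_add_le hf.1.1.aemeasurable (fun x => 1 - f x) (Q i))
      simp
    have h3 : ENNReal.ofReal m + ENNReal.ofReal m + ENNReal.ofReal m ≤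
        ENNReal.ofReal m + ENNReal.ofReal m + V (Q i) := by
      calc ENNReal.ofReal m + ENNReal.ofReal m + ENNReal.ofReal m = ENNReal.ofReal (3 * m) := by
            rw [← ENNReal.ofReal_add hm.le hm.le, ← ENNReal.ofReal_add (by linarith) hm.le]
            congr 1; ring
        _ ≤ fMeas f (Q i) + W (Q i) := (hvol i).1.trans hle
        _ = fMeas f (Q i) + (V (Q i) + ν (Q i)) := by rw [← Measure.add_apply V, hVν]
        _ ≤ ENNReal.ofReal m + (V (Q i) + ENNReal.ofReal m) := by
            gcongr
            · exact (measure_mono (subset_univ _)).trans hf.fMeas_univ_le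
            · exact (measure_mono (subset_univ _)).trans hνU
        _ = _ := by ring
    exact (ENNReal.add_le_add_iff_left (by finiteness)).1 h3
  have hVfin : ∀ i, V (Q i) ≠ ⊤ := by
    intro i
    refine ne_top_of_le_ne_top (hvol i).2 ?_
    calc V (Q i) ≤ W (Q i) := Measure.sub_le _
      _ ≤ fMeas (fun _ => (1 : ℝ)) (Q i) := fMeas_mono (fun x => by linarith [(hf.1.2 x).1]) _
      _ = volume (Q i) := by rw [fMeas_one]
  obtain ⟨η, hη1, hη2, hη3⟩ := exists_transport_in_cells hQ hdisj hU μ V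
    (fun i => ((measure_mono (subset_univ _)).trans hμU).trans (hVm i))
    (fun i => ((ENNReal.ofReal_pos.2 hm).trans_le (hVm i)).ne') hVfin
  have hηρ : ∀ᵐ p ∂η, dist p.1 p.2 ≤ ρ := by
    filter_upwards [hη3] with p ⟨i, hp1, hp2⟩ using hdiam i _ hp1 _ hp2
  refine ⟨γ.restrict Fᶜ + η, ⟨?_, ?_⟩, ?_, ?_⟩
  · rw [Measure.map_add _ _ measurable_fst, hη1, hμ, ← Measure.map_add _ _ measurable_fst,
      Measure.restrict_compl_add_restrict hFm, hγ1]
  · rw [Measure.map_add _ _ measurable_snd, ← hν, ← hW, ← hVν, add_comm V]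
    exact add_le_add le_rfl hη2
  · have hηU : η univ = γ F := by
      rw [← Measure.restrict_apply_univ F, ← preimage_univ (f := Prod.fst),
        ← Measure.map_apply measurable_fst MeasurableSet.univ, hη1, hμ,
        Measure.map_apply measurable_fst MeasurableSet.univ]
    unfold planCost
    rw [lintegral_add_measure, ← lintegral_add_compl (μ := γ) _ hFm, add_comm (∫⁻ _ in F, _ ∂γ)]
    refine add_le_add le_rfl ?_
    calc ∫⁻ p, ENNReal.ofReal (transCost k p.1 p.2) ∂η
        ≤ ∫⁻ _, ENNReal.ofReal K ∂η := by
          refine lintegral_mono_ae ?_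
          filter_upwards [hηρ] with p hp
          refine ENNReal.ofReal_le_ofReal (hK (mem_image_of_mem _ ?_))
          rwa [mem_closedBall_zero_iff, ← dist_eq_norm, dist_comm]
      _ = ∫⁻ _ in F, ENNReal.ofReal K ∂γ := by
          rw [lintegral_const, hηU, setLIntegral_const]
      _ ≤ ∫⁻ p in F, ENNReal.ofReal (transCost k p.1 p.2) ∂γ := by
          refine setLIntegral_mono' hFm fun p hp => ENNReal.ofReal_le_ofReal (hr _ ?_)
          rw [← dist_eq_norm, dist_comm]
          exact (le_max_right _ _).trans_lt hp
  · rw [ae_add_measure_iff]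
    refine ⟨?_, hηρ.mono fun p hp => hp.trans (le_max_left _ _)⟩
    filter_upwards [ae_restrict_mem hFm.compl] with p hp
    exact not_lt.1 hp

lemma msupport_eq_support {α : Type*} [TopologicalSpace α] [MeasurableSpace α] (μ : Measure α) :
    msupport μ = μ.support := by
  ext x
  rw [(nhds_basis_opens x).mem_measureSupport]
  exact ⟨fun h U hU => h U hU.2 hU.1, fun h U hU hx => h U ⟨hx, hU⟩⟩

/-- Plans of `f₁` and `f₂` whose targets live in disjoint sets `A₁`, `A₂`, with `A₁` free of `f₂`
and `A₂` free of `f₁`, add up to a plan of `f₁ + f₂`. -/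
lemma add_mem_extPlans {d : ℕ} {f₁ f₂ : Rd d → ℝ} (hf₁ : InUnit f₁) (hf₂ : InUnit f₂)
    {γ₁ γ₂ : Measure (Rd d × Rd d)} (hγ₁ : γ₁ ∈ ExtPlans f₁) (hγ₂ : γ₂ ∈ ExtPlans f₂)
    {A₁ A₂ : Set (Rd d)} (hA₂ : MeasurableSet A₂) (hA : Disjoint A₁ A₂)
    (hγA₁ : γ₁.map Prod.snd A₁ᶜ = 0) (hγA₂ : γ₂.map Prod.snd A₂ᶜ = 0)
    (h₁ : fMeas f₁ A₂ = 0) (h₂ : fMeas f₂ A₁ = 0) :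
    γ₁ + γ₂ ∈ ExtPlans fun x => f₁ x + f₂ x := by
  refine ⟨?_, ?_⟩
  · rw [Measure.map_add _ _ measurable_fst, hγ₁.1, hγ₂.1,
      fMeas_add hf₁.1.aemeasurable (fun x => (hf₁.2 x).1) (fun x => (hf₂.2 x).1)]
  · set g : Rd d → ℝ := fun x => 1 - (f₁ x + f₂ x) with hg
    have key : ∀ {u w : Rd d → ℝ} {ν : Measure (Rd d)} {A : Set (Rd d)}, AEMeasurable u →
        (∀ x, 1 - w x = u x + g x) → ν ≤ fMeas (fun x => 1 - w x) → ν Aᶜ = 0 →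
        fMeas u A = 0 → ∀ E, ν E ≤ fMeas g (E ∩ A) := by
      intro u w ν A hu huw hν hνA huA E
      calc ν E ≤ ν (E ∩ A) + ν (E \ A) := measure_le_inter_add_sdiff _ _ _
        _ = ν (E ∩ A) := by
          rw [measure_mono_null (s := E \ A) (fun x hx => hx.2) hνA, add_zero]
        _ ≤ fMeas (fun x => u x + g x) (E ∩ A) := by
          simp only [huw] at hν
          exact hν _
        _ ≤ fMeas u (E ∩ A) + fMeas g (E ∩ A) := fMeas_add_le hu g _
        _ = fMeas g (E ∩ A) := by
          rw [measure_mono_null inter_subset_right huA, zero_add]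
    refine Measure.le_iff.2 fun E hE => ?_
    rw [Measure.map_add _ _ measurable_snd, Measure.add_apply]
    calc γ₁.map Prod.snd E + γ₂.map Prod.snd E ≤ fMeas g (E ∩ A₁) + fMeas g (E ∩ A₂) :=
          add_le_add
            (key hf₂.1.aemeasurable (w := f₁) (fun x => by simp only [hg]; ring) hγ₁.2 hγA₁ h₂ E)
            (key hf₁.1.aemeasurable (w := f₂) (fun x => by simp only [hg]; ring) hγ₂.2 hγA₂ h₁ E)
      _ = fMeas g ((E ∩ A₁) ∪ (E ∩ A₂)) :=
          (measure_union (hA.mono inter_subset_right inter_subset_right) (hE.inter hA₂)).symm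
      _ ≤ fMeas g E := measure_mono (union_subset inter_subset_left inter_subset_left)

/-- Restricting a plan of `f₁ + f₂` to a set of sources carrying `f₁` but not `f₂` gives a plan
of `f₁`. -/
lemma restrict_mem_extPlans {d : ℕ} {f f₁ f₂ : Rd d → ℝ} (hf : ∀ x, f x = f₁ x + f₂ x)
    (hf₁ : InUnit f₁) (hf₂ : InUnit f₂)
    {γ : Measure (Rd d × Rd d)} (hγ : γ ∈ ExtPlans f)
    {S : Set (Rd d)} (hS : MeasurableSet S) (h₁ : fMeas f₁ Sᶜ = 0) (h₂ : fMeas f₂ S = 0) :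
    γ.restrict (Prod.fst ⁻¹' S) ∈ ExtPlans f₁ := by
  obtain rfl : f = fun x => f₁ x + f₂ x := funext hf
  refine ⟨?_, ?_⟩
  · rw [← Measure.restrict_map measurable_fst hS, hγ.1,
      fMeas_add hf₁.1.aemeasurable (fun x => (hf₁.2 x).1) (fun x => (hf₂.2 x).1),
      Measure.restrict_add, Measure.restrict_eq_zero.2 h₂, add_zero]
    exact Measure.restrict_eq_self_of_ae_mem h₁
  · exact ((Measure.map_mono Measure.restrict_le_self measurable_snd).trans hγ.2).trans
      (fMeas_mono fun x => by linarith [(hf₂.2 x).1])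

/-- A plan of `f` with displacement at most `D` has its target inside the open
`(D + 1)`-neighbourhood of any set carrying `f`. -/
lemma map_snd_compl_thickening_eq_zero {d : ℕ} {f : Rd d → ℝ} {γ : Measure (Rd d × Rd d)}
    (hγ : γ ∈ ExtPlans f) {D : ℝ} (hD : ∀ᵐ p ∂γ, dist p.1 p.2 ≤ D)
    {S : Set (Rd d)} (hS : fMeas f Sᶜ = 0) :
    γ.map Prod.snd (Metric.thickening (D + 1) S)ᶜ = 0 := by
  rw [Measure.map_apply measurable_snd Metric.isOpen_thickening.measurableSet.compl]
  have hmem : ∀ᵐ p ∂γ, p.1 ∈ S :=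
    ae_of_ae_map measurable_fst.aemeasurable (p := fun x => x ∈ S) (by rw [hγ.1]; exact hS)
  refine measure_mono_null (t := {p | ¬ (p.1 ∈ S ∧ dist p.1 p.2 ≤ D)}) ?_ (hmem.and hD)
  rintro p hp ⟨hpS, hpD⟩
  refine hp (Metric.mem_thickening_iff.2 ⟨p.1, hpS, ?_⟩)
  rw [dist_comm]
  linarith

/-- under (H1), for every `m > 0` there is `R = R(m)` such that `Υ` is additive
on pairs `f₁, f₂ ∈ L¹_m` with `f₁ + f₂ ≤ 1` whose supports are at distance at least `R`. -/
theorem stmt_10 {d : ℕ} (hd : 1 ≤ d) (k : Rd d → ℝ) (hpos : ∀ x, 0 ≤ k x) (h1 : H1 k)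
    (m : ℝ) (hm : 0 < m) :
    ∃ R : ℝ, ∀ f₁ f₂ : Rd d → ℝ, MemL1m m f₁ → MemL1m m f₂ →
      (∀ x, f₁ x + f₂ x ≤ 1) →
      (∀ a ∈ msupport (fMeas f₁), ∀ b ∈ msupport (fMeas f₂), R ≤ dist a b) →
      Ups (transCost k) (fun x => f₁ x + f₂ x) =
        Ups (transCost k) f₁ + Ups (transCost k) f₂ := by
  obtain ⟨D, hD⟩ := exists_plan_bounded_displacement hd h1 hm
  refine ⟨2 * (max D 0 + 1), fun f₁ f₂ hf₁ hf₂ _ hdist => ?_⟩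
  have hD' : 0 ≤ max D 0 := le_max_right _ _
  rw [msupport_eq_support, msupport_eq_support] at hdist
  set S₁ := (fMeas f₁).support
  set S₂ := (fMeas f₂).support
  have hS₁ : fMeas f₁ S₁ᶜ = 0 := Measure.measure_compl_support
  have hS₂ : fMeas f₂ S₂ᶜ = 0 := Measure.measure_compl_support
  have hS₁m : MeasurableSet S₁ := Measure.isClosed_support.measurableSet
  have hS₂m : MeasurableSet S₂ := Measure.isClosed_support.measurableSet
  set A₁ := Metric.thickening (D + 1) S₁
  set A₂ := Metric.thickening (D + 1) S₂
  have hS₁₂ : Disjoint S₁ S₂ := by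
    refine Set.disjoint_left.2 fun x hx hx' => ?_
    have := hdist x hx x hx'
    rw [dist_self] at this
    linarith
  have hDle : D ≤ max D 0 := le_max_left _ _
  have hA : Disjoint A₁ A₂ := by
    refine Set.disjoint_left.2 fun y hy hy' => ?_
    obtain ⟨a, ha, hya⟩ := Metric.mem_thickening_iff.1 hy
    obtain ⟨b, hb, hyb⟩ := Metric.mem_thickening_iff.1 hy'
    have := hdist a ha b hb
    have := dist_triangle_left a b y
    linarith
  have hAS₁ : A₁ ⊆ S₂ᶜ := by
    intro y hy hy'
    obtain ⟨a, ha, hya⟩ := Metric.mem_thickening_iff.1 hy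
    have := hdist a ha y hy'
    rw [dist_comm] at this
    linarith
  have hAS₂ : A₂ ⊆ S₁ᶜ := by
    intro y hy hy'
    obtain ⟨b, hb, hyb⟩ := Metric.mem_thickening_iff.1 hy
    have := hdist y hy' b hb
    linarith
  refine le_antisymm ?_ ?_
  · unfold Ups
    refine ENNReal.le_iInf₂_add_iInf₂ fun γ₁ hγ₁ γ₂ hγ₂ => ?_
    obtain ⟨γ₁', hγ₁', hc₁, hd₁⟩ := hD f₁ hf₁ γ₁ hγ₁
    obtain ⟨γ₂', hγ₂', hc₂, hd₂⟩ := hD f₂ hf₂ γ₂ hγ₂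
    refine (iInf₂_le (γ₁' + γ₂') (add_mem_extPlans hf₁.1 hf₂.1 hγ₁' hγ₂'
      Metric.isOpen_thickening.measurableSet hA
      (map_snd_compl_thickening_eq_zero hγ₁' hd₁ hS₁)
      (map_snd_compl_thickening_eq_zero hγ₂' hd₂ hS₂)
      (measure_mono_null hAS₂ hS₁) (measure_mono_null hAS₁ hS₂))).trans ?_
    refine le_trans (le_of_eq ?_) (add_le_add hc₁ hc₂)
    exact lintegral_add_measure _ _ _
  · refine le_iInf₂ fun γ hγ => ?_
    have h₁ := restrict_mem_extPlans (fun _ => rfl) hf₁.1 hf₂.1 hγ hS₁m hS₁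
      (measure_mono_null hS₁₂.subset_compl_right hS₂)
    have h₂ := restrict_mem_extPlans (fun x => add_comm (f₁ x) (f₂ x)) hf₂.1 hf₁.1 hγ hS₂m hS₂
      (measure_mono_null hS₁₂.subset_compl_left hS₁)
    refine (add_le_add (iInf₂_le _ h₁) (iInf₂_le _ h₂)).trans ?_
    unfold planCost
    rw [← lintegral_union (measurable_fst hS₂m) (hS₁₂.preimage _)]
    exact setLIntegral_le_lintegral _ _
end
end

section
/- Assume c(x,y) = k(y−x) with k satisfying (H1). For every m > 0 there exists a constant C = C(m) > 0 such that for all f_1, f_2 ∈ L^1_m one has |Υ(f_1) − Υ(f_2)| ≤ C·‖f_1 − f_2‖_{L^1(ℝ^d)}. -/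
open MeasureTheory ENNReal Filter Set

noncomputable section

theorem exists_plan_of_fiberwise_le {X ι : Type*} [MeasurableSpace X] [Countable ι]
    [MeasurableSpace ι] [MeasurableSingletonClass ι] {φ : X → ι} (hφ : Measurable φ)
    (μ ν : Measure X) [IsFiniteMeasure μ] (hle : ∀ i, μ (φ ⁻¹' {i}) ≤ ν (φ ⁻¹' {i}))
    (hfin : ∀ i, ν (φ ⁻¹' {i}) ≠ ∞) :
    ∃ γ : Measure (X × X), γ.map Prod.fst = μ ∧ γ.map Prod.snd ≤ ν ∧
      ∀ᵐ p ∂γ, φ p.1 = φ p.2 := by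
  have hQ : ∀ i, MeasurableSet (φ ⁻¹' {i}) := fun i => hφ (measurableSet_singleton i)
  have hsum : ∀ ρ : Measure X, Measure.sum (fun i => ρ.restrict (φ ⁻¹' {i})) = ρ := by
    intro ρ
    rw [← Measure.restrict_iUnion _ hQ]
    · rw [← preimage_iUnion, iUnion_of_singleton, preimage_univ, Measure.restrict_univ]
    · intro i j hij
      exact Disjoint.preimage φ (by simpa using hij)
  have hfinite : ∀ i, IsFiniteMeasure (ν.restrict (φ ⁻¹' {i})) := fun i =>
    ⟨by simpa using (hfin i).lt_top⟩
  have hν : SFinite ν := hsum ν ▸ inferInstance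
  refine ⟨Measure.sum fun i => (ν (φ ⁻¹' {i}))⁻¹ •
    (μ.restrict (φ ⁻¹' {i})).prod (ν.restrict (φ ⁻¹' {i})), ?_, ?_, ?_⟩
  · rw [Measure.map_sum measurable_fst.aemeasurable]
    conv_rhs => rw [← hsum μ]
    congr 1
    funext i
    rw [Measure.map_smul, Measure.map_fst_prod, Measure.restrict_apply_univ, smul_smul]
    by_cases h0 : ν (φ ⁻¹' {i}) = 0
    · have hμ0 : μ (φ ⁻¹' {i}) = 0 := le_antisymm ((hle i).trans h0.le) zero_le
      rw [Measure.restrict_eq_zero.2 hμ0, smul_zero]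
    · rw [ENNReal.inv_mul_cancel h0 (hfin i), one_smul]
  · rw [Measure.map_sum measurable_snd.aemeasurable]
    conv_rhs => rw [← hsum ν]
    refine Measure.le_iff.2 fun s hs => ?_
    rw [Measure.sum_apply _ hs, Measure.sum_apply _ hs]
    refine ENNReal.tsum_le_tsum fun i => ?_
    rw [Measure.map_smul, Measure.map_snd_prod, Measure.restrict_apply_univ, smul_smul,
      Measure.smul_apply, smul_eq_mul]
    refine mul_le_of_le_one_left zero_le ?_
    rw [mul_comm, ← div_eq_mul_inv]
    exact ENNReal.div_le_of_le_mul (by simpa using hle i)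
  · refine Measure.ae_sum_iff.2 fun i => Measure.ae_smul_measure ?_ _
    rw [Measure.prod_restrict]
    filter_upwards [ae_restrict_mem ((hQ i).prod (hQ i))] with p hp
    exact hp.1.trans hp.2.symm

/-- The index of the cube of side `ℓ` containing a point. -/
def cubeIndex {d : ℕ} (ℓ : ℝ) (x : Rd d) : Fin d → ℤ := fun i => ⌊x i / ℓ⌋

theorem measurable_cubeIndex {d : ℕ} (ℓ : ℝ) : Measurable (cubeIndex (d := d) ℓ) := by
  refine measurable_pi_lambda _ fun i => Int.measurable_floor.comp ?_
  fun_prop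

theorem volume_cubeIndex_preimage {d : ℕ} {ℓ : ℝ} (hℓ : 0 < ℓ) (n : Fin d → ℤ) :
    volume (cubeIndex (d := d) ℓ ⁻¹' {n}) = ENNReal.ofReal (ℓ ^ d) := by
  have h : cubeIndex (d := d) ℓ ⁻¹' {n} = (WithLp.ofLp : Rd d → (Fin d → ℝ)) ⁻¹'
      (Set.univ.pi fun i => Set.Ico (n i * ℓ) ((n i + 1) * ℓ)) := by
    ext x
    simp only [mem_preimage, mem_singleton_iff, funext_iff, cubeIndex, Set.mem_pi, mem_univ,
      true_imp_iff, Int.floor_eq_iff, le_div_iff₀ hℓ, div_lt_iff₀ hℓ, mem_Ico]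
  rw [h, (PiLp.volume_preserving_ofLp (Fin d)).measure_preimage
    (MeasurableSet.univ_pi fun i => measurableSet_Ico).nullMeasurableSet, Real.volume_pi_Ico]
  simp [add_mul, ENNReal.ofReal_pow hℓ.le]

theorem exists_bound_of_cubeIndex_eq {d : ℕ} {k : Rd d → ℝ} (hk : Continuous k) {ℓ : ℝ}
    (hℓ : 0 < ℓ) :
    ∃ K : ℝ, 0 < K ∧ ∀ x y : Rd d, cubeIndex ℓ x = cubeIndex ℓ y → k (y - x) ≤ K := by
  have hcomp : IsCompact (WithLp.toLp 2 '' (Set.univ.pi fun _ : Fin d => Set.Icc (-ℓ) ℓ)) :=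
    (isCompact_univ_pi fun _ => isCompact_Icc).image (PiLp.continuous_toLp 2 _)
  obtain ⟨K, hK⟩ := (hcomp.image hk).bddAbove
  refine ⟨max K 1, by positivity, fun x y hxy => le_max_of_le_left (hK ⟨y - x, ?_, rfl⟩)⟩
  refine ⟨WithLp.ofLp (y - x), fun i _ => ?_, rfl⟩
  have hi : ⌊x i / ℓ⌋ = ⌊y i / ℓ⌋ := congrFun hxy i
  have habs := Int.abs_sub_lt_one_of_floor_eq_floor hi.symm
  rw [← sub_div, abs_div, abs_of_pos hℓ, div_lt_one hℓ] at habs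
  exact abs_le.1 habs.le

theorem exists_plan_le_const_mul {d : ℕ} (hd : 1 ≤ d) {k : Rd d → ℝ} (hk : Continuous k)
    {m : ℝ} (hm : 0 < m) :
    ∃ K : ℝ, 0 < K ∧ ∀ μ ν ρ : Measure (Rd d), ν + ρ = volume →
      μ univ ≤ ENNReal.ofReal m → ρ univ ≤ ENNReal.ofReal (2 * m) →
      ∃ γ : Measure (Rd d × Rd d), γ.map Prod.fst = μ ∧ γ.map Prod.snd ≤ ν ∧
        planCost (transCost k) γ ≤ ENNReal.ofReal K * μ univ := by
  have hℓ : 0 < 3 * m + 1 := by positivity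
  have hpow : 3 * m ≤ (3 * m + 1) ^ d :=
    (by linarith : 3 * m ≤ 3 * m + 1).trans
      (le_self_pow₀ (by linarith) (Nat.one_le_iff_ne_zero.1 hd))
  obtain ⟨K, hK0, hK⟩ := exists_bound_of_cubeIndex_eq hk hℓ
  refine ⟨K, hK0, fun μ ν ρ hvol hμ hρ => ?_⟩
  have : IsFiniteMeasure μ := ⟨hμ.trans_lt ofReal_lt_top⟩
  have hcube : ∀ n, ν (cubeIndex (3 * m + 1) ⁻¹' {n}) + ρ (cubeIndex (3 * m + 1) ⁻¹' {n}) =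
      ENNReal.ofReal ((3 * m + 1) ^ d) := fun n => by
    rw [← Measure.add_apply, hvol, volume_cubeIndex_preimage hℓ]
  have hle : ∀ n, μ (cubeIndex (3 * m + 1) ⁻¹' {n}) ≤ ν (cubeIndex (3 * m + 1) ⁻¹' {n}) := by
    intro n
    refine (measure_mono (subset_univ _)).trans (hμ.trans ?_)
    refine (ENNReal.add_le_add_iff_right (ofReal_ne_top (r := 2 * m))).1 ?_
    rw [← ENNReal.ofReal_add hm.le (by positivity)]
    calc ENNReal.ofReal (m + 2 * m) ≤ ENNReal.ofReal ((3 * m + 1) ^ d) :=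
          ENNReal.ofReal_le_ofReal (by linarith)
      _ ≤ _ := by
          rw [← hcube n]
          gcongr
          exact (measure_mono (subset_univ _)).trans hρ
  have hfin : ∀ n, ν (cubeIndex (3 * m + 1) ⁻¹' {n}) ≠ ∞ := fun n =>
    ne_top_of_le_ne_top (ofReal_ne_top (r := (3 * m + 1) ^ d)) (le_self_add.trans (hcube n).le)
  obtain ⟨γ, hfst, hsnd, hγ⟩ :=
    exists_plan_of_fiberwise_le (measurable_cubeIndex (3 * m + 1)) μ ν hle hfin
  refine ⟨γ, hfst, hsnd, ?_⟩
  calc planCost (transCost k) γ ≤ ∫⁻ _, ENNReal.ofReal K ∂γ :=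
        lintegral_mono_ae (hγ.mono fun p hp => ENNReal.ofReal_le_ofReal (hK _ _ hp))
    _ = ENNReal.ofReal K * μ univ := by
        rw [lintegral_const, ← hfst, Measure.map_apply measurable_fst MeasurableSet.univ,
          preimage_univ]

/-- The fraction of the density `u` that fits below `v`. -/
def trimRatio {X : Type*} (u v : X → ℝ) (x : X) : ℝ := min (u x) (v x) / u x

section trimRatio

variable {X : Type*} {u v : X → ℝ}

theorem trimRatio_nonneg (hu : ∀ x, 0 ≤ u x) (hv : ∀ x, 0 ≤ v x) (x : X) :
    0 ≤ trimRatio u v x := div_nonneg (le_min (hu x) (hv x)) (hu x)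

theorem trimRatio_le_one (hu : ∀ x, 0 ≤ u x) (x : X) : trimRatio u v x ≤ 1 :=
  div_le_one_of_le₀ (min_le_left _ _) (hu x)

theorem mul_trimRatio (hu : ∀ x, 0 ≤ u x) (hv : ∀ x, 0 ≤ v x) (x : X) :
    u x * trimRatio u v x = min (u x) (v x) := by
  rcases (hu x).eq_or_lt with h | h
  · rw [← h, zero_mul, min_eq_left (hv x)]
  · exact mul_div_cancel₀ _ h.ne'

theorem measurable_trimRatio [MeasurableSpace X] (hu : Measurable u) (hv : Measurable v) :
    Measurable (trimRatio u v) := (hu.min hv).div hu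

end trimRatio

theorem map_withDensity_trimRatio_le {d : ℕ} {Z : Type*} [MeasurableSpace Z] {γ : Measure Z}
    {π : Z → Rd d} (hπ : Measurable π) {u v : Rd d → ℝ} (hu : Measurable u) (hv : Measurable v)
    (hu0 : ∀ x, 0 ≤ u x) (hv0 : ∀ x, 0 ≤ v x) (hγ : γ.map π ≤ fMeas u) :
    (γ.withDensity fun z => ENNReal.ofReal (trimRatio u v (π z))).map π ≤ fMeas v := by
  have hr : Measurable fun x => ENNReal.ofReal (trimRatio u v x) :=
    (measurable_trimRatio hu hv).ennreal_ofReal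
  refine Measure.le_iff.2 fun s hs => ?_
  rw [Measure.map_apply hπ hs, withDensity_apply _ (hπ hs), ← setLIntegral_map hs hr hπ]
  calc ∫⁻ x in s, ENNReal.ofReal (trimRatio u v x) ∂γ.map π
      ≤ ∫⁻ x in s, ENNReal.ofReal (trimRatio u v x) ∂fMeas u :=
        lintegral_mono' (Measure.restrict_mono le_rfl hγ) le_rfl
    _ = ∫⁻ x in s, ENNReal.ofReal (u x) * ENNReal.ofReal (trimRatio u v x) :=
        setLIntegral_withDensity_eq_setLIntegral_mul _ hu.ennreal_ofReal hr hs
    _ ≤ ∫⁻ x in s, ENNReal.ofReal (v x) := lintegral_mono fun x => by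
        rw [← ENNReal.ofReal_mul (hu0 x), mul_trimRatio hu0 hv0]
        exact ENNReal.ofReal_le_ofReal (min_le_right _ _)
    _ = fMeas v s := (withDensity_apply _ hs).symm

theorem lintegral_one_sub_trimRatio_le {d : ℕ} {Z : Type*} [MeasurableSpace Z] {γ : Measure Z}
    {π : Z → Rd d} (hπ : Measurable π) {u v : Rd d → ℝ} (hu : Measurable u) (hv : Measurable v)
    (hu0 : ∀ x, 0 ≤ u x) (hv0 : ∀ x, 0 ≤ v x) (hγ : γ.map π ≤ fMeas u) :
    ∫⁻ z, ENNReal.ofReal (1 - trimRatio u v (π z)) ∂γ ≤ ∫⁻ x, ENNReal.ofReal |v x - u x| := by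
  have hr : Measurable fun x => ENNReal.ofReal (1 - trimRatio u v x) :=
    ((measurable_trimRatio hu hv).const_sub 1).ennreal_ofReal
  rw [← lintegral_map hr hπ]
  calc ∫⁻ x, ENNReal.ofReal (1 - trimRatio u v x) ∂γ.map π
      ≤ ∫⁻ x, ENNReal.ofReal (1 - trimRatio u v x) ∂fMeas u := lintegral_mono' hγ le_rfl
    _ = ∫⁻ x, ENNReal.ofReal (u x) * ENNReal.ofReal (1 - trimRatio u v x) :=
        lintegral_withDensity_eq_lintegral_mul _ hu.ennreal_ofReal hr
    _ ≤ ∫⁻ x, ENNReal.ofReal |v x - u x| := lintegral_mono fun x => by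
        rw [← ENNReal.ofReal_mul (hu0 x), mul_sub, mul_one, mul_trimRatio hu0 hv0]
        refine ENNReal.ofReal_le_ofReal ?_
        rcases min_choice (u x) (v x) with h | h <;> rw [h]
        · simp
        · rw [abs_sub_comm]
          exact le_abs_self _

theorem exists_trimmed_plan {d : ℕ} {f g : Rd d → ℝ} (hf : Measurable f) (hg : Measurable g)
    (hf01 : ∀ x, 0 ≤ f x ∧ f x ≤ 1) (hg01 : ∀ x, 0 ≤ g x ∧ g x ≤ 1)
    {γ : Measure (Rd d × Rd d)} (hγ : γ ∈ ExtPlans g) :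
    ∃ γ' ≤ γ, γ'.map Prod.fst ≤ fMeas f ∧ γ'.map Prod.snd ≤ (fMeas fun x => 1 - f x) ∧
      γ univ ≤ γ' univ + 2 * ∫⁻ x, ENNReal.ofReal |f x - g x| := by
  have hf' := hf.const_sub 1
  have hg' := hg.const_sub 1
  have hf0 := fun x => (hf01 x).1
  have hg0 := fun x => (hg01 x).1
  have hf0' : ∀ x, 0 ≤ 1 - f x := fun x => sub_nonneg.2 (hf01 x).2
  have hg0' : ∀ x, 0 ≤ 1 - g x := fun x => sub_nonneg.2 (hg01 x).2
  set a := trimRatio g f with ha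
  set b := trimRatio (fun x => 1 - g x) (fun x => 1 - f x) with hb
  have ham : Measurable a := measurable_trimRatio hg hf
  have hbm : Measurable b := measurable_trimRatio hg' hf'
  have ha0 : ∀ x, 0 ≤ a x := trimRatio_nonneg hg0 hf0
  have hb0 : ∀ x, 0 ≤ b x := trimRatio_nonneg hg0' hf0'
  have ha1 : ∀ x, a x ≤ 1 := trimRatio_le_one hg0
  have hb1 : ∀ x, b x ≤ 1 := trimRatio_le_one hg0'
  refine ⟨γ.withDensity fun p => ENNReal.ofReal (a p.1 * b p.2), ?_, ?_, ?_, ?_⟩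
  · conv_rhs => rw [← withDensity_one (μ := γ)]
    refine withDensity_mono (ae_of_all _ fun p => ?_)
    exact ENNReal.ofReal_le_one.2 (mul_le_one₀ (ha1 _) (hb0 _) (hb1 _))
  · refine le_trans (Measure.map_mono (withDensity_mono (ae_of_all _ fun p => ?_)) measurable_fst)
      (map_withDensity_trimRatio_le measurable_fst hg hf hg0 hf0 hγ.1.le)
    exact ENNReal.ofReal_le_ofReal (mul_le_of_le_one_right (ha0 _) (hb1 _))
  · refine le_trans (Measure.map_mono (withDensity_mono (ae_of_all _ fun p => ?_)) measurable_snd)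
      (map_withDensity_trimRatio_le measurable_snd hg' hf' hg0' hf0' hγ.2)
    exact ENNReal.ofReal_le_ofReal (mul_le_of_le_one_left (hb0 _) (ha1 _))
  · have h₁ := lintegral_one_sub_trimRatio_le measurable_fst hg hf hg0 hf0 hγ.1.le
    have h₂ := lintegral_one_sub_trimRatio_le measurable_snd hg' hf' hg0' hf0' hγ.2
    have hswap : ∀ x, |(1 - f x) - (1 - g x)| = |f x - g x| := fun x => by
      rw [_root_.sub_sub_sub_cancel_left, abs_sub_comm]
    simp only [hswap, ← hb] at h₂
    rw [← ha] at h₁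
    rw [withDensity_apply _ MeasurableSet.univ, Measure.restrict_univ, two_mul]
    refine le_trans ?_ (add_le_add_right (add_le_add h₁ h₂) _)
    rw [← lintegral_add_left (by fun_prop), ← lintegral_add_left (by fun_prop), ← lintegral_one]
    refine lintegral_mono fun p => ?_
    have h₁ := sub_nonneg.2 (ha1 p.1)
    have h₂ := sub_nonneg.2 (hb1 p.2)
    rw [← ENNReal.ofReal_add h₁ h₂,
      ← ENNReal.ofReal_add (mul_nonneg (ha0 _) (hb0 _)) (add_nonneg h₁ h₂)]
    exact ENNReal.one_le_ofReal.2 (by nlinarith [mul_nonneg h₁ h₂])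

theorem fMeas_add_fMeas_one_sub {d : ℕ} {f : Rd d → ℝ} (hf : Measurable f)
    (hf01 : ∀ x, 0 ≤ f x ∧ f x ≤ 1) : fMeas f + (fMeas fun x => 1 - f x) = volume := by
  rw [fMeas, fMeas, ← withDensity_add_left hf.ennreal_ofReal]
  conv_rhs => rw [← withDensity_one (μ := volume)]
  congr 1
  funext x
  simp [← ENNReal.ofReal_add (hf01 x).1 (sub_nonneg.2 (hf01 x).2)]

theorem fMeas_univ {d : ℕ} {f : Rd d → ℝ} (hf : InUnit f) :
    fMeas f univ = ENNReal.ofReal (∫ x, f x) := by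
  rw [fMeas, withDensity_apply _ MeasurableSet.univ, Measure.restrict_univ,
    ofReal_integral_eq_lintegral_ofReal hf.1 (ae_of_all _ fun x => (hf.2 x).1)]

theorem fMeas_univ_le_add {d : ℕ} {f g : Rd d → ℝ} (hg : Measurable g) (hg0 : ∀ x, 0 ≤ g x) :
    fMeas f univ ≤ fMeas g univ + ∫⁻ x, ENNReal.ofReal |f x - g x| := by
  rw [fMeas, fMeas, withDensity_apply _ MeasurableSet.univ, withDensity_apply _ MeasurableSet.univ,
    Measure.restrict_univ, ← lintegral_add_left hg.ennreal_ofReal]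
  refine lintegral_mono fun x => ?_
  rw [← ENNReal.ofReal_add (hg0 x) (abs_nonneg _)]
  exact ENNReal.ofReal_le_ofReal (by linarith [le_abs_self (f x - g x)])

theorem MemL1m.exists_measurable {d : ℕ} {m : ℝ} {f : Rd d → ℝ} (hf : MemL1m m f) :
    ∃ f' : Rd d → ℝ, Measurable f' ∧ MemL1m m f' ∧ f =ᵐ[volume] f' := by
  have hmk := hf.1.1.aestronglyMeasurable
  have hae : f =ᵐ[volume] fun x => max 0 (min 1 (hmk.mk f x)) := by
    filter_upwards [hmk.ae_eq_mk] with x hx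
    rw [← hx, min_eq_right (hf.1.2 x).2, max_eq_right (hf.1.2 x).1]
  have hmeas := hmk.stronglyMeasurable_mk.measurable
  refine ⟨_, measurable_const.max (measurable_const.min hmeas), ⟨⟨hf.1.1.congr hae, fun x =>
    ⟨le_max_left _ _, max_le zero_le_one (min_le_left _ _)⟩⟩, ?_⟩, hae⟩
  rw [← integral_congr_ae hae]
  exact hf.2

theorem Ups_congr_ae {d : ℕ} (c : Rd d → Rd d → ℝ) {f g : Rd d → ℝ} (h : f =ᵐ[volume] g) :
    Ups c f = Ups c g := by
  have h₁ : fMeas f = fMeas g := withDensity_congr_ae (h.mono fun x hx => by simp [hx])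
  have h₂ : (fMeas fun x => 1 - f x) = fMeas fun x => 1 - g x :=
    withDensity_congr_ae (h.mono fun x hx => by simp [hx])
  simp only [Ups, ExtPlans, h₁, h₂]

theorem Ups_le_add_of_measurable {d : ℕ} {k : Rd d → ℝ} {m K : ℝ}
    (hK : ∀ μ ν ρ : Measure (Rd d), ν + ρ = volume →
      μ univ ≤ ENNReal.ofReal m → ρ univ ≤ ENNReal.ofReal (2 * m) →
      ∃ γ : Measure (Rd d × Rd d), γ.map Prod.fst = μ ∧ γ.map Prod.snd ≤ ν ∧
        planCost (transCost k) γ ≤ ENNReal.ofReal K * μ univ)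
    (hm : 0 < m) {f g : Rd d → ℝ} (hf : Measurable f) (hg : Measurable g)
    (hfm : MemL1m m f) (hgm : MemL1m m g) :
    Ups (transCost k) f ≤ Ups (transCost k) g +
      ENNReal.ofReal K * (3 * ∫⁻ x, ENNReal.ofReal |f x - g x|) := by
  rw [← tsub_le_iff_right]
  refine le_iInf₂ fun γ hγ => tsub_le_iff_right.2 ?_
  obtain ⟨γ', hle, hfst, hsnd, hmass⟩ := exists_trimmed_plan hf hg hfm.1.2 hgm.1.2 hγ
  have hfuniv : fMeas f univ ≤ ENNReal.ofReal m :=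
    (fMeas_univ hfm.1).le.trans (ENNReal.ofReal_le_ofReal hfm.2)
  have hfst_univ : γ'.map Prod.fst univ = γ' univ := by
    rw [Measure.map_apply measurable_fst MeasurableSet.univ, preimage_univ]
  have hsnd_univ : γ'.map Prod.snd univ = γ' univ := by
    rw [Measure.map_apply measurable_snd MeasurableSet.univ, preimage_univ]
  have hγ'univ : γ' univ ≤ ENNReal.ofReal m := hfst_univ ▸ (hfst univ).trans hfuniv
  have hfin₁ : IsFiniteMeasure (γ'.map Prod.fst) :=
    ⟨by rw [hfst_univ]; exact hγ'univ.trans_lt ofReal_lt_top⟩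
  have hfin₂ : IsFiniteMeasure (γ'.map Prod.snd) :=
    ⟨by rw [hsnd_univ]; exact hγ'univ.trans_lt ofReal_lt_top⟩
  have hμ := Measure.sub_add_cancel_of_le hfst
  have hν := Measure.sub_add_cancel_of_le hsnd
  set μ := fMeas f - γ'.map Prod.fst
  set ν := (fMeas fun x => 1 - f x) - γ'.map Prod.snd
  obtain ⟨η, hη₁, hη₂, hη⟩ := hK μ ν (γ'.map Prod.snd + fMeas f)
    (by rw [← add_assoc, hν, add_comm, fMeas_add_fMeas_one_sub hf hfm.1.2])
    ((Measure.sub_le univ).trans hfuniv)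
    (by
      rw [Measure.add_apply, hsnd_univ, two_mul, ENNReal.ofReal_add hm.le hm.le]
      exact add_le_add hγ'univ hfuniv)
  have hplan : γ' + η ∈ ExtPlans f := by
    refine ⟨?_, ?_⟩
    · rw [Measure.map_add _ _ measurable_fst, hη₁, add_comm, hμ]
    · rw [Measure.map_add _ _ measurable_snd, add_comm]
      exact (add_le_add_left hη₂ _).trans hν.le
  have hμmass : μ univ ≤ 3 * ∫⁻ x, ENNReal.ofReal |f x - g x| := by
    refine (ENNReal.add_le_add_iff_right (hγ'univ.trans_lt ofReal_lt_top).ne).1 ?_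
    have hgγ : fMeas g univ = γ univ := by
      rw [← hγ.1, Measure.map_apply measurable_fst MeasurableSet.univ, preimage_univ]
    calc μ univ + γ' univ = fMeas f univ := by rw [← hfst_univ, ← Measure.add_apply, hμ]
      _ ≤ γ univ + ∫⁻ x, ENNReal.ofReal |f x - g x| :=
          hgγ ▸ fMeas_univ_le_add hg fun x => (hgm.1.2 x).1
      _ ≤ γ' univ + 2 * (∫⁻ x, ENNReal.ofReal |f x - g x|) +
            ∫⁻ x, ENNReal.ofReal |f x - g x| := by gcongr
      _ = 3 * (∫⁻ x, ENNReal.ofReal |f x - g x|) + γ' univ := by ring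
  calc Ups (transCost k) f ≤ planCost (transCost k) (γ' + η) := iInf₂_le _ hplan
    _ = planCost (transCost k) γ' + planCost (transCost k) η := lintegral_add_measure _ _ _
    _ ≤ _ := add_le_add (lintegral_mono' hle le_rfl) (hη.trans (by gcongr))

theorem exists_Ups_le_add {d : ℕ} (hd : 1 ≤ d) {k : Rd d → ℝ} (hk : Continuous k) {m : ℝ}
    (hm : 0 < m) :
    ∃ C : ℝ, 0 < C ∧ ∀ f g : Rd d → ℝ, MemL1m m f → MemL1m m g →
      Ups (transCost k) f ≤ Ups (transCost k) g + ENNReal.ofReal (C * ∫ x, |f x - g x|) := by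
  obtain ⟨K, hK0, hK⟩ := exists_plan_le_const_mul hd hk hm
  refine ⟨K * 3, by positivity, fun f g hf hg => ?_⟩
  obtain ⟨f', hf'meas, hf', hff'⟩ := hf.exists_measurable
  obtain ⟨g', hg'meas, hg', hgg'⟩ := hg.exists_measurable
  have hint : ∫ x, |f x - g x| = ∫ x, |f' x - g' x| :=
    integral_congr_ae (by filter_upwards [hff', hgg'] with x h₁ h₂; rw [h₁, h₂])
  rw [Ups_congr_ae _ hff', Ups_congr_ae _ hgg', hint, ENNReal.ofReal_mul (by positivity),
    ENNReal.ofReal_mul hK0.le, mul_assoc,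
    ofReal_integral_eq_lintegral_ofReal (f := fun x => |f' x - g' x|) (hf'.1.1.sub hg'.1.1).abs
      (ae_of_all _ fun x => abs_nonneg _)]
  simpa using Ups_le_add_of_measurable hK hm hf'meas hg'meas hf' hg'

/-- under (H1), `Υ` is Lipschitz continuous for the `L¹` distance on `L¹_m`:
there is `C = C(m) > 0` with `|Υ(f₁) − Υ(f₂)| ≤ C ‖f₁ − f₂‖_{L¹}` (stated as the two
one-sided inequalities in `ℝ≥0∞`). -/
theorem stmt_11 {d : ℕ} (hd : 1 ≤ d) (k : Rd d → ℝ) (hpos : ∀ x, 0 ≤ k x) (h1 : H1 k)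
    (m : ℝ) (hm : 0 < m) :
    ∃ C : ℝ, 0 < C ∧ ∀ f₁ f₂ : Rd d → ℝ, MemL1m m f₁ → MemL1m m f₂ →
      Ups (transCost k) f₁ ≤
        Ups (transCost k) f₂ + ENNReal.ofReal (C * ∫ x, |f₁ x - f₂ x|) ∧
      Ups (transCost k) f₂ ≤
        Ups (transCost k) f₁ + ENNReal.ofReal (C * ∫ x, |f₁ x - f₂ x|) := by
  obtain ⟨C, hC, h⟩ := exists_Ups_le_add hd h1.1 hm
  refine ⟨C, hC, fun f₁ f₂ hf₁ hf₂ => ⟨h f₁ f₂ hf₁ hf₂, ?_⟩⟩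
  simpa only [abs_sub_comm] using h f₂ f₁ hf₂ hf₁
end
end
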